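/- Let N ≥ 1, c > 0, and h_1, …, h_N > 0. The per-beam sum-rate f(p) = Σ_{i=1}^{N} log₂((h_i²·a_i(p) + c)/(h_i²·a_{i+1}(p) + c)) is strictly increasing in the first coordinate p_1: if p' differs from p only by p'_1 > p_1 ≥ 0 (with p_i ≥ 0 for all i), then f(p') > f(p), while R_i(p') = R_i(p) for every i ≥ 2. Consequently, any maximizer of f over the feasible set {p ≥ 0 : Σ_i p_i ≤ P_max, R_i(p) ≥ R̄_i ∀i} (assumed nonempty) uses full power: Σ_{i=1}^{N} p_i = P_max. -/

import Mathlib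

open Finset

/-- Cumulative power `a_i = Σ_{l=i}^{N} p_l` (so `a_{N+1} = 0`). -/
noncomputable def cumPow (N : ℕ) (p : ℕ → ℝ) (i : ℕ) : ℝ := ∑ l ∈ Finset.Icc i N, p l

/-- Per-user SIC rate `R_i(p) = log₂((hᵢ²·aᵢ(p) + c)/(hᵢ²·a_{i+1}(p) + c))`. -/
noncomputable def rate (N : ℕ) (h : ℕ → ℝ) (c : ℝ) (p : ℕ → ℝ) (i : ℕ) : ℝ :=
  Real.logb 2 (((h i) ^ 2 * cumPow N p i + c) / ((h i) ^ 2 * cumPow N p (i + 1) + c))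

/-- Per-beam sum rate `f(p) = Σ_{i=1}^{N} R_i(p)`. -/
noncomputable def sumRate (N : ℕ) (h : ℕ → ℝ) (c : ℝ) (p : ℕ → ℝ) : ℝ :=
  ∑ i ∈ Finset.Icc 1 N, rate N h c p i

theorem cumPow_nonneg {N : ℕ} {p : ℕ → ℝ} (hp : ∀ i ∈ Finset.Icc 1 N, 0 ≤ p i) {i : ℕ}
    (hi : 1 ≤ i) : 0 ≤ cumPow N p i :=
  Finset.sum_nonneg fun l hl =>
    hp l (Finset.mem_Icc.2 ⟨hi.trans (Finset.mem_Icc.1 hl).1, (Finset.mem_Icc.1 hl).2⟩)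

theorem cumPow_eq_of_two_le {N : ℕ} {p p' : ℕ → ℝ} (hpp' : ∀ i, i ≠ 1 → p' i = p i) {i : ℕ}
    (hi : 2 ≤ i) : cumPow N p' i = cumPow N p i :=
  Finset.sum_congr rfl fun l hl => hpp' l (by have := (Finset.mem_Icc.1 hl).1; omega)

theorem cumPow_one {N : ℕ} (hN : 1 ≤ N) (p : ℕ → ℝ) : cumPow N p 1 = p 1 + cumPow N p 2 :=
  (Finset.add_sum_Ioc_eq_sum_Icc (f := p) hN).symm

theorem rate_eq_of_two_le {N : ℕ} (h : ℕ → ℝ) (c : ℝ) {p p' : ℕ → ℝ}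
    (hpp' : ∀ i, i ≠ 1 → p' i = p i) {i : ℕ} (hi : 2 ≤ i) :
    rate N h c p' i = rate N h c p i := by
  simp only [rate, cumPow_eq_of_two_le hpp' hi,
    cumPow_eq_of_two_le hpp' (show 2 ≤ i + 1 by omega)]

theorem rate_one_lt {N : ℕ} (hN : 1 ≤ N) {h : ℕ → ℝ} {c : ℝ} (hc : 0 < c) (hh : 0 < h 1)
    {p p' : ℕ → ℝ} (hp : ∀ i ∈ Finset.Icc 1 N, 0 ≤ p i) (hpp' : ∀ i, i ≠ 1 → p' i = p i)
    (hlt : p 1 < p' 1) : rate N h c p 1 < rate N h c p' 1 := by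
  have h1 : 0 ≤ cumPow N p 1 := cumPow_nonneg hp le_rfl
  have h2 : 0 ≤ cumPow N p (1 + 1) := cumPow_nonneg hp (by norm_num)
  have hcum : cumPow N p 1 < cumPow N p' 1 := by
    rw [cumPow_one hN, cumPow_one hN, cumPow_eq_of_two_le hpp' le_rfl]
    linarith
  have e : cumPow N p' (1 + 1) = cumPow N p (1 + 1) := cumPow_eq_of_two_le hpp' le_rfl
  unfold rate
  rw [e]
  apply Real.logb_lt_logb (by norm_num) (by positivity)
  gcongr

theorem sumRate_lt {N : ℕ} (hN : 1 ≤ N) {h : ℕ → ℝ} {c : ℝ} (hc : 0 < c) (hh : 0 < h 1)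
    {p p' : ℕ → ℝ} (hp : ∀ i ∈ Finset.Icc 1 N, 0 ≤ p i) (hpp' : ∀ i, i ≠ 1 → p' i = p i)
    (hlt : p 1 < p' 1) : sumRate N h c p < sumRate N h c p' := by
  have hrate := rate_one_lt hN hc hh hp hpp' hlt
  refine Finset.sum_lt_sum (fun i hi => ?_) ⟨1, Finset.mem_Icc.2 ⟨le_rfl, hN⟩, hrate⟩
  rcases (Finset.mem_Icc.1 hi).1.eq_or_lt with rfl | h2
  · exact hrate.le
  · exact (rate_eq_of_two_le h c hpp' h2).ge

/-- the sum rate is strictly increasing in `p₁` (increasing the power of the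
first-decoded user leaves all other rates unchanged); consequently any maximizer of the
sum rate over the feasible set uses full power `Σ pᵢ = P_max`. -/
theorem sum_rate_increasing_in_p1_and_full_power
    (N : ℕ) (hN : 1 ≤ N) (h : ℕ → ℝ) (c : ℝ) (hc : 0 < c)
    (hh : ∀ i ∈ Finset.Icc 1 N, 0 < h i)
    (Pmax : ℝ) (hP : 0 < Pmax) (Rbar : ℕ → ℝ)
    (hR : ∀ i ∈ Finset.Icc 1 N, 0 ≤ Rbar i) :
    (∀ p p' : ℕ → ℝ, (∀ i ∈ Finset.Icc 1 N, 0 ≤ p i) →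
        (∀ i, i ≠ 1 → p' i = p i) → p 1 < p' 1 →
        sumRate N h c p < sumRate N h c p' ∧
          ∀ i ∈ Finset.Icc 2 N, rate N h c p' i = rate N h c p i) ∧
    (∀ p : ℕ → ℝ,
        p ∈ {q : ℕ → ℝ | (∀ i ∈ Finset.Icc 1 N, 0 ≤ q i) ∧
              (∑ i ∈ Finset.Icc 1 N, q i ≤ Pmax) ∧
              (∀ i ∈ Finset.Icc 1 N, rate N h c q i ≥ Rbar i)} →
        IsMaxOn (sumRate N h c)
          {q : ℕ → ℝ | (∀ i ∈ Finset.Icc 1 N, 0 ≤ q i) ∧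
              (∑ i ∈ Finset.Icc 1 N, q i ≤ Pmax) ∧
              (∀ i ∈ Finset.Icc 1 N, rate N h c q i ≥ Rbar i)} p →
        ∑ i ∈ Finset.Icc 1 N, p i = Pmax) := by
  have h1N : 1 ∈ Finset.Icc 1 N := Finset.mem_Icc.2 ⟨le_rfl, hN⟩
  refine ⟨fun p p' hp hpp' hlt => ⟨sumRate_lt hN hc (hh 1 h1N) hp hpp' hlt,
    fun i hi => rate_eq_of_two_le h c hpp' (Finset.mem_Icc.1 hi).1⟩, ?_⟩
  rintro p ⟨hp, hsum, hrate⟩ hmax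
  by_contra hne
  have hslack : ∑ i ∈ Finset.Icc 1 N, p i < Pmax := lt_of_le_of_ne hsum hne
  let p' := Function.update p 1 (p 1 + (Pmax - ∑ i ∈ Finset.Icc 1 N, p i))
  have hp'1 : p' 1 = p 1 + (Pmax - ∑ i ∈ Finset.Icc 1 N, p i) := Function.update_self ..
  have hpp' : ∀ i, i ≠ 1 → p' i = p i := fun i hi => Function.update_of_ne hi _ _
  have hlt : p 1 < p' 1 := by linarith
  refine (sumRate_lt hN hc (hh 1 h1N) hp hpp' hlt).not_ge (hmax ⟨fun i hi => ?_, ?_, fun i hi => ?_⟩)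
  · rcases eq_or_ne i 1 with rfl | hi1
    · exact (hp 1 hi).trans hlt.le
    · exact (hpp' i hi1).symm ▸ hp i hi
  · have e' := cumPow_one hN p'
    have e := cumPow_one hN p
    rw [cumPow_eq_of_two_le hpp' le_rfl] at e'
    simp only [cumPow] at e e'
    linarith
  · rcases (Finset.mem_Icc.1 hi).1.eq_or_lt with rfl | h2
    · exact (hrate 1 hi).le.trans (rate_one_lt hN hc (hh 1 h1N) hp hpp' hlt).le
    · exact (rate_eq_of_two_le h c hpp' h2).symm ▸ hrate i hi
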